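/- Let f : C → C be a homeomorphism of the Cantor ternary set, let X be the quotient space obtained from C × [0,1] by identifying, for each p ∈ C, the point (p,1) with (f(p),0), let φ : C×[0,1] → X be the quotient map and σ = φ × φ. Fix δ with 0 < δ < 1/10. Define V₁ = {((p,s),(q,t)) ∈ (C×[0,1])² : |p−q| < δ and |t−s| < δ}, V₂ = {((p,s),(q,t)) ∈ (C×[0,1])² : |p−f(q)| < δ, s < δ and 1−δ < t}, V₃ = {((p,s),(q,t)) ∈ (C×[0,1])² : |f(p)−q| < δ, t < δ and 1−δ < s}, V₀ = V₁ ∪ V₂ ∪ V₃, and K = (C×[0,1])² \ V₀. Then for every p, q ∈ C there exists a nonempty compact connected subset E of X² with E ⊆ σ(K) such that σ((p,0),(q,1/2)) ∈ E and σ((f(p),0),(f(q),1/2)) ∈ E. -/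

import Mathlib

open Set

noncomputable section

/-- The Cantor ternary set, as a topological (metric) space. -/
abbrev CantorT : Type := ↥cantorSet

/-- The unit interval `[0,1]` as a subspace of `ℝ`. -/
abbrev UnitI : Type := ↥(Set.Icc (0:ℝ) 1)

/-- The product `C × [0,1]`. -/
abbrev CI : Type := CantorT × UnitI

/-- `V₁ = {((p,s),(q,t)) : |p−q| < δ and |t−s| < δ}`. -/
def V1 (δ : ℝ) : Set (CI × CI) :=
  {z | |(z.1.1 : ℝ) - (z.2.1 : ℝ)| < δ ∧ |(z.2.2 : ℝ) - (z.1.2 : ℝ)| < δ}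

/-- `V₂ = {((p,s),(q,t)) : |p−f(q)| < δ, s < δ and 1−δ < t}`. -/
def V2 (f : CantorT → CantorT) (δ : ℝ) : Set (CI × CI) :=
  {z | |(z.1.1 : ℝ) - (f z.2.1 : ℝ)| < δ ∧ (z.1.2 : ℝ) < δ ∧ 1 - δ < (z.2.2 : ℝ)}

/-- `V₃ = {((p,s),(q,t)) : |f(p)−q| < δ, t < δ and 1−δ < s}`. -/
def V3 (f : CantorT → CantorT) (δ : ℝ) : Set (CI × CI) :=
  {z | |(f z.1.1 : ℝ) - (z.2.1 : ℝ)| < δ ∧ (z.2.2 : ℝ) < δ ∧ 1 - δ < (z.1.2 : ℝ)}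

/-- `V₀ = V₁ ∪ V₂ ∪ V₃`. -/
def V0 (f : CantorT → CantorT) (δ : ℝ) : Set (CI × CI) := V1 δ ∪ V2 f δ ∪ V3 f δ

/-- `K = (C×[0,1])² \ V₀`. -/
def Kset (f : CantorT → CantorT) (δ : ℝ) : Set (CI × CI) := (V0 f δ)ᶜ

/-- The identification relation on `C × [0,1]`: the point `(p,1)` is glued to `(f p, 0)`. -/
def glueRel (f : CantorT → CantorT) (a b : CI) : Prop :=
  (a.2 : ℝ) = 1 ∧ b.1 = f a.1 ∧ (b.2 : ℝ) = 0

/-- The quotient space `X` obtained from `C × [0,1]` by identifying `(p,1)` with `(f p, 0)`,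
with the quotient topology. -/
abbrev GlueSpace (f : CantorT → CantorT) : Type := Quot (glueRel f)

/-- The quotient map `φ : C × [0,1] → X`. -/
def glueMap (f : CantorT → CantorT) : CI → GlueSpace f := Quot.mk (glueRel f)

/-- The map `σ = φ × φ : (C × [0,1])² → X²`. -/
def sigmaMap (f : CantorT → CantorT) : CI × CI → GlueSpace f × GlueSpace f :=
  Prod.map (glueMap f) (glueMap f)

theorem glueMap_cont (f : CantorT → CantorT) : Continuous (glueMap f) := continuous_quot_mk

theorem sigmaMap_cont (f : CantorT → CantorT) : Continuous (sigmaMap f) :=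
  (glueMap_cont f).prodMap (glueMap_cont f)

def loH (u : UnitI) : UnitI := ⟨(u : ℝ) / 2, by have := u.2.1; have := u.2.2; constructor <;> linarith⟩

def hiH (u : UnitI) : UnitI :=
  ⟨1 / 2 + (u : ℝ) / 2, by have := u.2.1; have := u.2.2; constructor <;> linarith⟩

theorem loH_cont : Continuous loH := by unfold loH; fun_prop

theorem hiH_cont : Continuous hiH := by unfold hiH; fun_prop

def pathA (p q : CantorT) (u : UnitI) : CI × CI := ((p, loH u), (q, hiH u))

def pathB (p q : CantorT) (u : UnitI) : CI × CI := ((p, hiH u), (q, loH u))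

theorem pathA_cont (p q : CantorT) : Continuous (pathA p q) := by
  have := loH_cont
  have := hiH_cont
  unfold pathA; fun_prop

theorem pathB_cont (p q : CantorT) : Continuous (pathB p q) := by
  have := loH_cont
  have := hiH_cont
  unfold pathB; fun_prop

theorem pathA_mem (f : CantorT → CantorT) (δ : ℝ) (hδ' : δ < 1/10) (p q : CantorT) (u : UnitI) :
    pathA p q u ∈ Kset f δ := by
  have h0 := u.2.1
  have h1 := u.2.2
  rintro ((⟨-, h⟩ | ⟨-, h, h'⟩) | ⟨-, h, h'⟩)
  · have := (abs_lt.1 h).2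
    simp only [pathA, loH, hiH] at this
    linarith
  all_goals
    simp only [pathA, loH, hiH] at h h'
    linarith

theorem pathB_mem (f : CantorT → CantorT) (δ : ℝ) (hδ' : δ < 1/10) (p q : CantorT) (u : UnitI) :
    pathB p q u ∈ Kset f δ := by
  have h0 := u.2.1
  have h1 := u.2.2
  rintro ((⟨-, h⟩ | ⟨-, h, h'⟩) | ⟨-, h, h'⟩)
  · have := (abs_lt.1 h).1
    simp only [pathB, loH, hiH] at this
    linarith
  all_goals
    simp only [pathB, loH, hiH] at h h'
    linarith

/-- Claim 4: for all `p, q ∈ C` there is a subcontinuum `E` of `X²` with `E ⊆ σ(K)`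
containing both `σ((p,0),(q,1/2))` and `σ((f p,0),(f q,1/2))`. -/
theorem claim4_subcontinuum_joining_orbit_points
    (f : CantorT ≃ₜ CantorT) (δ : ℝ) (hδ : 0 < δ) (hδ' : δ < 1/10)
    (p q : CantorT) :
    ∃ E : Set (GlueSpace ⇑f × GlueSpace ⇑f), IsCompact E ∧ IsConnected E ∧
      E ⊆ sigmaMap ⇑f '' Kset ⇑f δ ∧
      sigmaMap ⇑f ((p, (⟨0, by norm_num⟩ : UnitI)), (q, (⟨1/2, by norm_num⟩ : UnitI))) ∈ E ∧
      sigmaMap ⇑f ((f p, (⟨0, by norm_num⟩ : UnitI)), (f q, (⟨1/2, by norm_num⟩ : UnitI))) ∈ E := by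
  have cA : Continuous (fun u => sigmaMap ⇑f (pathA p q u)) :=
    (sigmaMap_cont _).comp (pathA_cont p q)
  have cB : Continuous (fun u => sigmaMap ⇑f (pathB p (f q) u)) :=
    (sigmaMap_cont _).comp (pathB_cont p (f q))
  have : ConnectedSpace UnitI := Subtype.connectedSpace (isConnected_Icc zero_le_one)
  refine ⟨range (fun u => sigmaMap ⇑f (pathA p q u)) ∪
    range (fun u => sigmaMap ⇑f (pathB p (f q) u)),
    (isCompact_range cA).union (isCompact_range cB),
    IsConnected.union ?_ (isConnected_range cA) (isConnected_range cB), ?_, ?_, ?_⟩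
  · refine ⟨sigmaMap ⇑f (pathA p q ⟨1, by norm_num⟩), ⟨_, rfl⟩, ⟨⟨0, by norm_num⟩, ?_⟩⟩
    refine Prod.ext ?_ ?_
    · simp [sigmaMap, pathA, pathB, loH, hiH]
    · refine (Quot.sound ⟨?_, rfl, ?_⟩).symm
      · simp [pathA, hiH]; norm_num
      · simp [pathB, loH]
  · rintro _ (⟨u, rfl⟩ | ⟨u, rfl⟩)
    · exact ⟨_, pathA_mem _ δ hδ' _ _ _, rfl⟩
    · exact ⟨_, pathB_mem _ δ hδ' _ _ _, rfl⟩
  · refine Or.inl ⟨⟨0, by norm_num⟩, ?_⟩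
    simp [sigmaMap, pathA, loH, hiH]
  · refine Or.inr ⟨⟨1, by norm_num⟩, ?_⟩
    refine Prod.ext ?_ ?_
    · refine Quot.sound ⟨?_, rfl, rfl⟩
      simp [pathB, hiH]; norm_num
    · simp [sigmaMap, pathB, loH]
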